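/- arXiv:2304.03172 — 7 statements merged into one kernel-verified Lean document; each statement's English description precedes it below -/
import Mathlib

section
/- Let N ≥ 1 and m be natural numbers, let G be a connected simple graph on Fin N with Laplacian L, and set 𝐋 = L ⊗ I_m (acting on vectors indexed by Fin N × Fin m), with 𝐋^{1/2} its positive semidefinite square root. For each i ∈ Fin N let Uᵢ be a real m×dᵢ matrix and Yᵢ ∈ ℝ^m. Let Û be the block-diagonal map sending x = (x₁,…,x_N), xᵢ ∈ ℝ^{dᵢ}, to the stacked vector (Û x)(i,·) = Uᵢ xᵢ, and let Ŷ be the stacked vector Ŷ(i,·) = Yᵢ. Define f̂(x,w) = (1/2)‖Û x − Ŷ − 𝐋^{1/2} w‖₂² for w ∈ ℝ^{N·m}, and f(x) = (1/2)‖∑_{i=1}^N (Uᵢ xᵢ − Yᵢ)‖₂². If (x⋆, w⋆) is a global minimizer of f̂, then x⋆ is a global minimizer of f. -/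
open Matrix Kronecker

/-- The Euclidean (ℓ²) norm of a finitely-indexed real vector. -/
noncomputable def l2norm {ι : Type*} [Fintype ι] (v : ι → ℝ) : ℝ :=
  ‖(WithLp.equiv 2 (ι → ℝ)).symm v‖

theorem l2norm_sq {ι : Type*} [Fintype ι] (v : ι → ℝ) : l2norm v ^ 2 = ∑ i, v i ^ 2 := by
  simp [l2norm, EuclideanSpace.norm_sq_eq]

theorem kronecker_one_mulVec {n m : Type*} [Fintype n] [Fintype m] [DecidableEq m]
    (A : Matrix n n ℝ) (z : n × m → ℝ) (q : n × m) :
    ((A ⊗ₖ (1 : Matrix m m ℝ)) *ᵥ z) q = (A *ᵥ fun i => z (i, q.2)) q.1 := by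
  simp [Matrix.mulVec, dotProduct, Fintype.sum_prod_type, Matrix.one_apply]

/-- The kernel of a symmetric square root of `L ⊗ I` consists of the consensus vectors. -/
theorem sqrt_lapMatrix_mulVec_eq_zero_iff {V m : Type*} [Fintype V] [DecidableEq V]
    [Fintype m] [DecidableEq m] {G : SimpleGraph V} [DecidableRel G.Adj] (hG : G.Connected)
    {S : Matrix (V × m) (V × m) ℝ} (hS : S.IsHermitian)
    (hS2 : S * S = (G.lapMatrix ℝ) ⊗ₖ (1 : Matrix m m ℝ)) (z : V × m → ℝ) :
    S *ᵥ z = 0 ↔ ∀ i i' j, z (i, j) = z (i', j) := by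
  have h : S *ᵥ z = 0 ↔ (S * S) *ᵥ z = 0 := by
    have := Matrix.conjTranspose_mul_self_mulVec_eq_zero S z
    rw [hS.eq] at this
    exact this.symm
  rw [h, hS2]
  constructor
  · intro hz i i' j
    refine (SimpleGraph.lapMatrix_mulVec_eq_zero_iff_forall_reachable G
      (x := fun i => z (i, j))).1 ?_ i i' (hG.preconnected i i')
    ext k
    rw [← kronecker_one_mulVec (G.lapMatrix ℝ) z (k, j), hz]
    rfl
  · intro hz
    ext ⟨k, j⟩
    rw [kronecker_one_mulVec]
    exact congrFun ((SimpleGraph.lapMatrix_mulVec_eq_zero_iff_forall_reachable G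
      (x := fun i => z (i, j))).2 fun i i' _ => hz i i' j) k

/-- A vector orthogonal to the kernel of a symmetric matrix lies in its range. -/
theorem exists_mulVec_eq_of_forall_dotProduct_eq_zero {n : Type*} [Fintype n] [DecidableEq n]
    {S : Matrix n n ℝ} (hS : S.IsHermitian) (v : n → ℝ)
    (hv : ∀ z, S *ᵥ z = 0 → v ⬝ᵥ z = 0) : ∃ w, S *ᵥ w = v := by
  have hsym := Matrix.isSymmetric_toEuclideanLin_iff.2 hS
  have hmem : WithLp.toLp 2 v ∈ (Matrix.toEuclideanLin S).range := by
    rw [← Submodule.orthogonal_orthogonal (Matrix.toEuclideanLin S).range,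
      hsym.orthogonal_range, Submodule.mem_orthogonal]
    intro u hu
    have hu0 : S *ᵥ u.ofLp = 0 := congrArg WithLp.ofLp (LinearMap.mem_ker.1 hu)
    have := hv _ hu0
    simpa [EuclideanSpace.inner_eq_star_dotProduct] using this
  obtain ⟨w, hw⟩ := hmem
  exact ⟨w.ofLp, congrArg WithLp.ofLp hw⟩

/-- The blocks of a vector in the range of a symmetric square root of `L ⊗ I` sum to zero. -/
theorem sum_sqrt_lapMatrix_mulVec {V m : Type*} [Fintype V] [DecidableEq V]
    [Fintype m] [DecidableEq m] {G : SimpleGraph V} [DecidableRel G.Adj] (hG : G.Connected)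
    {S : Matrix (V × m) (V × m) ℝ} (hS : S.IsHermitian)
    (hS2 : S * S = (G.lapMatrix ℝ) ⊗ₖ (1 : Matrix m m ℝ)) (w : V × m → ℝ) (j : m) :
    ∑ i, (S *ᵥ w) (i, j) = 0 := by
  let z : V × m → ℝ := fun q => if q.2 = j then 1 else 0
  have hz : S *ᵥ z = 0 :=
    (sqrt_lapMatrix_mulVec_eq_zero_iff hG hS hS2 z).2 fun _ _ _ => rfl
  have hT : Sᵀ = S := by simpa using hS.eq
  have h0 : z ⬝ᵥ (S *ᵥ w) = 0 := by
    rw [Matrix.dotProduct_mulVec, ← Matrix.mulVec_transpose, hT, hz, zero_dotProduct]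
  simpa [z, dotProduct, Fintype.sum_prod_type] using h0

/-- A vector whose blocks sum to zero lies in the range of a symmetric square root of `L ⊗ I`. -/
theorem exists_sqrt_lapMatrix_mulVec_eq {V m : Type*} [Fintype V] [DecidableEq V]
    [Fintype m] [DecidableEq m] {G : SimpleGraph V} [DecidableRel G.Adj] (hG : G.Connected)
    {S : Matrix (V × m) (V × m) ℝ} (hS : S.IsHermitian)
    (hS2 : S * S = (G.lapMatrix ℝ) ⊗ₖ (1 : Matrix m m ℝ)) (v : V × m → ℝ)
    (hv : ∀ j, ∑ i, v (i, j) = 0) : ∃ w, S *ᵥ w = v := by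
  refine exists_mulVec_eq_of_forall_dotProduct_eq_zero hS v fun z hz => ?_
  have hc := (sqrt_lapMatrix_mulVec_eq_zero_iff hG hS hS2 z).1 hz
  obtain ⟨i₀⟩ := hG.nonempty
  rw [dotProduct, Fintype.sum_prod_type_right]
  refine Finset.sum_eq_zero fun j _ => ?_
  rw [Finset.sum_congr rfl fun i _ => by rw [hc i i₀ j], ← Finset.sum_mul, hv j, zero_mul]

/-- Cauchy–Schwarz for the sum of the blocks of a stacked vector. -/
theorem l2norm_sum_sq_le {V m : Type*} [Fintype V] [Fintype m] (v : V × m → ℝ) :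
    l2norm (fun j => ∑ i, v (i, j)) ^ 2 ≤ Fintype.card V * l2norm v ^ 2 := by
  rw [l2norm_sq, l2norm_sq, Fintype.sum_prod_type_right, Finset.mul_sum]
  exact Finset.sum_le_sum fun j _ => sq_sum_le_card_mul_sum_sq

/-- Lemma 1 of the paper: if `(x⋆, w⋆)` is a global minimizer of the
slack-variable problem `f̂(x,w) = (1/2)‖Û x − Ŷ − 𝐋^{1/2} w‖₂²`, where `𝐋 = L ⊗ I_m`
for the Laplacian `L` of a connected graph `G` on `Fin N` (`N ≥ 1`), `𝐋^{1/2}` is its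
positive semidefinite square root, `Û` is the block-diagonal matrix of the `Uᵢ` and
`Ŷ` the stacked vector of the `Yᵢ`, then `x⋆` is a global minimizer of
`f(x) = (1/2)‖∑ᵢ (Uᵢ xᵢ − Yᵢ)‖₂²`. -/
theorem stmt_5 {N m : ℕ} (hN : 1 ≤ N) (G : SimpleGraph (Fin N)) [DecidableRel G.Adj]
    (hG : G.Connected) (d : Fin N → ℕ)
    (U : (i : Fin N) → Matrix (Fin m) (Fin (d i)) ℝ)
    (Y : Fin N → Fin m → ℝ)
    (Lsq : Matrix (Fin N × Fin m) (Fin N × Fin m) ℝ)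
    (hLsq : Lsq.PosSemidef)
    (hLsq2 : Lsq * Lsq = (G.lapMatrix ℝ) ⊗ₖ (1 : Matrix (Fin m) (Fin m) ℝ))
    (xstar : (i : Fin N) → Fin (d i) → ℝ) (wstar : Fin N × Fin m → ℝ)
    (hmin : ∀ (x : (i : Fin N) → Fin (d i) → ℝ) (w : Fin N × Fin m → ℝ),
        (1 / 2 : ℝ) * l2norm ((fun q : Fin N × Fin m =>
              (U q.1).mulVec (xstar q.1) q.2 - Y q.1 q.2) - Lsq.mulVec wstar) ^ 2
          ≤ (1 / 2 : ℝ) * l2norm ((fun q : Fin N × Fin m =>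
              (U q.1).mulVec (x q.1) q.2 - Y q.1 q.2) - Lsq.mulVec w) ^ 2) :
    ∀ x : (i : Fin N) → Fin (d i) → ℝ,
      (1 / 2 : ℝ) * l2norm (∑ i, ((U i).mulVec (xstar i) - Y i)) ^ 2
        ≤ (1 / 2 : ℝ) * l2norm (∑ i, ((U i).mulVec (x i) - Y i)) ^ 2 := by
  intro x
  have hH := hLsq.isHermitian
  have hN0 : (N : ℝ) ≠ 0 := by positivity
  let r : ((i : Fin N) → Fin (d i) → ℝ) → Fin N × Fin m → ℝ :=
    fun x q => (U q.1).mulVec (x q.1) q.2 - Y q.1 q.2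
  have hr : ∀ x, ∑ i, ((U i).mulVec (x i) - Y i) = fun j => ∑ i, r x (i, j) := by
    intro x
    ext j
    simp [r]
  let a : Fin N × Fin m → ℝ := fun q => (∑ i, r x (i, q.2)) / N
  obtain ⟨w, hw⟩ := exists_sqrt_lapMatrix_mulVec_eq hG hH hLsq2 (r x - a) fun j => by
    simp [a, Finset.sum_sub_distrib, mul_div_cancel₀ _ hN0]
  have hle : l2norm (r xstar - Lsq *ᵥ wstar) ^ 2 ≤ l2norm a ^ 2 := by
    have h : 1 / 2 * l2norm (r xstar - Lsq *ᵥ wstar) ^ 2 ≤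
        1 / 2 * l2norm (r x - Lsq *ᵥ w) ^ 2 := hmin x w
    rw [hw, sub_sub_cancel] at h
    linarith
  have hstar : l2norm (fun j => ∑ i, r xstar (i, j)) ^ 2 ≤
      N * l2norm (r xstar - Lsq *ᵥ wstar) ^ 2 := by
    simpa [Finset.sum_sub_distrib, sum_sqrt_lapMatrix_mulVec hG hH hLsq2] using
      l2norm_sum_sq_le (r xstar - Lsq *ᵥ wstar)
  have ha : N * l2norm a ^ 2 = l2norm (fun j => ∑ i, r x (i, j)) ^ 2 := by
    rw [l2norm_sq, l2norm_sq, Fintype.sum_prod_type_right, Finset.mul_sum]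
    refine Finset.sum_congr rfl fun j _ => ?_
    simp only [a, Finset.sum_const, Finset.card_univ, Fintype.card_fin, nsmul_eq_mul]
    field_simp
  rw [hr, hr]
  have := mul_le_mul_of_nonneg_left hle (Nat.cast_nonneg (α := ℝ) N)
  linarith
end

section
/- Let D and P be real n×n matrices with P positive semidefinite, let α, μ be real numbers such that (α² + μ)·DᵀPD − α·(DᵀP + PD) is negative semidefinite, and let z : ℕ → ℝ^n satisfy z(k+1) = z(k) − α·D z(k) for all k. Then for every natural number K, μ · ∑_{k=0}^{K−1} (D z(k))ᵀ P (D z(k)) ≤ z(0)ᵀ P z(0). -/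
open Matrix

/-- Moving a transpose across the dot product. -/
theorem dotProduct_transpose_mulVec_eq {m n R : Type*} [Fintype m] [Fintype n] [CommSemiring R]
    (A : Matrix m n R) (v : n → R) (w : m → R) : v ⬝ᵥ Aᵀ *ᵥ w = A *ᵥ v ⬝ᵥ w := by
  rw [dotProduct_mulVec, vecMul_transpose]

/-- One step of the Lyapunov function `v ↦ vᵀ P v` along `v ↦ v - α D v`. -/
theorem lyapunov_step {n R : Type*} [Fintype n] [CommRing R] (D P : Matrix n n R) (α μ : R)
    (v : n → R) :
    μ * (D *ᵥ v ⬝ᵥ P *ᵥ D *ᵥ v) + (v - α • D *ᵥ v) ⬝ᵥ P *ᵥ (v - α • D *ᵥ v) =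
      v ⬝ᵥ P *ᵥ v +
        v ⬝ᵥ ((α ^ 2 + μ) • (Dᵀ * P * D) - α • (Dᵀ * P + P * D)) *ᵥ v := by
  simp only [sub_mulVec, add_mulVec, smul_mulVec, mulVec_sub, mulVec_smul, ← mulVec_mulVec,
    sub_dotProduct, dotProduct_sub, dotProduct_add, smul_dotProduct, dotProduct_smul,
    smul_eq_mul, dotProduct_transpose_mulVec_eq]
  ring

/-- telescoped Lyapunov bound, eq. (16) of the paper: with `P` positive
semidefinite, `(α² + μ)·DᵀPD − α·(DᵀP + PD)` negative semidefinite, and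
`z(k+1) = z(k) − α D z(k)`, one has
`μ ∑_{k=0}^{K−1} (Dz(k))ᵀP(Dz(k)) ≤ z(0)ᵀPz(0)` for every `K`. -/
theorem stmt_7 {n : ℕ} (D P : Matrix (Fin n) (Fin n) ℝ) (hP : P.PosSemidef) (α μ : ℝ)
    (hneg : ∀ v : Fin n → ℝ,
      v ⬝ᵥ (((α ^ 2 + μ) • (Dᵀ * P * D) - α • (Dᵀ * P + P * D)).mulVec v) ≤ 0)
    (z : ℕ → Fin n → ℝ)
    (hz : ∀ k : ℕ, z (k + 1) = z k - α • D.mulVec (z k)) :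
    ∀ K : ℕ, μ * ∑ k ∈ Finset.range K,
        (D.mulVec (z k)) ⬝ᵥ P.mulVec (D.mulVec (z k)) ≤ z 0 ⬝ᵥ P.mulVec (z 0) := by
  intro K
  have telescoped : μ * ∑ k ∈ Finset.range K, D *ᵥ z k ⬝ᵥ P *ᵥ D *ᵥ z k + z K ⬝ᵥ P *ᵥ z K ≤
      z 0 ⬝ᵥ P *ᵥ z 0 := by
    induction K with
    | zero => simp
    | succ K ih =>
      rw [Finset.sum_range_succ, hz K]
      linarith [lyapunov_step D P α μ (z K), hneg (z K)]
  have nonneg : 0 ≤ z K ⬝ᵥ P *ᵥ z K := by simpa using hP.dotProduct_mulVec_nonneg (z K)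
  linarith
end

section
/- Let D and P be real n×n matrices with P positive definite, let α be real and μ > 0 be such that (α² + μ)·DᵀPD − α·(DᵀP + PD) is negative semidefinite, and let z : ℕ → ℝ^n satisfy z(k+1) = z(k) − α·D z(k) for all k. Then D z(k) → 0 as k → ∞. -/
open Matrix

open Filter Topology in
/-- A positive definite quadratic form detects convergence to zero. -/
theorem Matrix.PosDef.tendsto_zero_of_dotProduct_mulVec {ι κ : Type*} [Fintype ι]
    {P : Matrix ι ι ℝ} (hP : P.PosDef) {l : Filter κ} {r : κ → ι → ℝ}
    (hr : Tendsto (fun k => r k ⬝ᵥ P *ᵥ r k) l (𝓝 0)) : Tendsto r l (𝓝 0) := by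
  classical
  rw [tendsto_pi_nhds]
  intro i
  set w : ι → ℝ := P⁻¹ *ᵥ Pi.single i 1 with hw
  have hPw : P *ᵥ w = Pi.single i 1 := by
    rw [hw, mulVec_mulVec, mul_nonsing_inv _ ((isUnit_iff_isUnit_det _).1 hP.isUnit), one_mulVec]
  have hsymm (v : ι → ℝ) : w ⬝ᵥ P *ᵥ v = v i := by
    have hPt : Pᵀ = P := hP.isHermitian
    rw [dotProduct_mulVec, ← mulVec_transpose, hPt, hPw, single_one_dotProduct]
  have hsq (k : κ) : r k i ^ 2 ≤ w i * (r k ⬝ᵥ P *ᵥ r k) := by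
    have key (t : ℝ) : 0 ≤ w i * (t * t) + (2 * r k i) * t + r k ⬝ᵥ P *ᵥ r k := by
      have h := hP.posSemidef.dotProduct_mulVec_nonneg (t • w + r k)
      simp only [star_trivial, mulVec_add, mulVec_smul, add_dotProduct, dotProduct_add,
        smul_dotProduct, dotProduct_smul, hsymm, hPw, dotProduct_single_one, smul_eq_mul,
        Pi.add_apply, Pi.smul_apply] at h
      linarith
    have := discrim_le_zero key
    rw [discrim] at this
    linarith
  have hlim : Tendsto (fun k => r k i ^ 2) l (𝓝 0) :=
    squeeze_zero (fun k => sq_nonneg _) hsq (by simpa using hr.const_mul (w i))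
  have habs := hlim.sqrt
  simp only [Real.sqrt_sq_eq_abs, Real.sqrt_zero] at habs
  exact (tendsto_zero_iff_abs_tendsto_zero _).2 habs

open Filter Topology in
/-- If a nonnegative sequence decreases by at least `b k ≥ 0` at step `k`, then `b` tends to
zero. -/
theorem tendsto_zero_of_succ_add_le {a b : ℕ → ℝ} (ha : ∀ k, 0 ≤ a k) (hb : ∀ k, 0 ≤ b k)
    (hab : ∀ k, a (k + 1) + b k ≤ a k) : Tendsto b atTop (𝓝 0) := by
  have hanti : Antitone a := antitone_nat_of_succ_le fun k => by linarith [hab k, hb k]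
  have hlim := tendsto_atTop_ciInf hanti ⟨0, by rintro _ ⟨k, rfl⟩; exact ha k⟩
  have hdiff := hlim.sub (hlim.comp (tendsto_add_atTop_nat 1))
  rw [sub_self] at hdiff
  exact squeeze_zero hb (fun k => by simpa using by linarith [hab k]) hdiff

/-- proof of Theorem 1 of the paper: with `P` positive definite, `μ > 0`,
`(α² + μ)·DᵀPD − α·(DᵀP + PD)` negative semidefinite, and `z(k+1) = z(k) − α D z(k)`,
the consensus residual `D z(k)` tends to `0` as `k → ∞`. -/
theorem stmt_8 {n : ℕ} (D P : Matrix (Fin n) (Fin n) ℝ) (hP : P.PosDef) (α μ : ℝ)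
    (hμ : 0 < μ)
    (hneg : ∀ v : Fin n → ℝ,
      v ⬝ᵥ (((α ^ 2 + μ) • (Dᵀ * P * D) - α • (Dᵀ * P + P * D)).mulVec v) ≤ 0)
    (z : ℕ → Fin n → ℝ)
    (hz : ∀ k : ℕ, z (k + 1) = z k - α • D.mulVec (z k)) :
    Filter.Tendsto (fun k => D.mulVec (z k)) Filter.atTop (nhds 0) := by
  refine hP.tendsto_zero_of_dotProduct_mulVec ?_
  have hnonneg (v : Fin n → ℝ) : 0 ≤ v ⬝ᵥ P *ᵥ v := by
    simpa using hP.posSemidef.dotProduct_mulVec_nonneg v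
  have hdecay (k : ℕ) : z (k + 1) ⬝ᵥ P *ᵥ z (k + 1) + μ * (D *ᵥ z k ⬝ᵥ P *ᵥ D *ᵥ z k) ≤
      z k ⬝ᵥ P *ᵥ z k := by
    have htranspose (u v : Fin n → ℝ) : u ⬝ᵥ Dᵀ *ᵥ v = D *ᵥ u ⬝ᵥ v := by
      rw [dotProduct_mulVec, vecMul_transpose]
    have h := hneg (z k)
    simp only [sub_mulVec, add_mulVec, smul_mulVec, ← mulVec_mulVec, dotProduct_sub,
      dotProduct_add, dotProduct_smul, htranspose, smul_eq_mul] at h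
    rw [hz k]
    simp only [mulVec_sub, mulVec_smul, sub_dotProduct, dotProduct_sub, smul_dotProduct,
      dotProduct_smul, smul_eq_mul]
    linarith
  have hlim := tendsto_zero_of_succ_add_le (fun k => hnonneg (z k))
    (fun k => mul_nonneg hμ.le (hnonneg _)) hdecay
  simpa [hμ.ne'] using hlim.const_mul μ⁻¹
end

section
/- Let d be a natural number, β₁ ∈ [0,1), and let g : ℕ → ℝ^d be such that the series ∑_{k=1}^∞ ‖g(k)‖₂ converges with sum at most C. Define s₁ : ℕ → ℝ^d by s₁(0) = 0 and s₁(k) = β₁·s₁(k−1) + (1−β₁)·g(k) for k ≥ 1. Then the series ∑_{k=1}^∞ ‖s₁(k)/(1−β₁ᵏ)‖₂ converges and its sum is at most C/(1−β₁). -/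
theorem l2norm_nonneg {ι : Type*} [Fintype ι] (v : ι → ℝ) : 0 ≤ l2norm v :=
  norm_nonneg _

theorem l2norm_zero {ι : Type*} [Fintype ι] : l2norm (0 : ι → ℝ) = 0 := by
  simp [l2norm]

theorem l2norm_add_le {ι : Type*} [Fintype ι] (v w : ι → ℝ) :
    l2norm (v + w) ≤ l2norm v + l2norm w := by
  simpa [l2norm] using norm_add_le (WithLp.toLp 2 v) (WithLp.toLp 2 w)

theorem l2norm_smul_of_nonneg {ι : Type*} [Fintype ι] {c : ℝ} (hc : 0 ≤ c) (v : ι → ℝ) :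
    l2norm (c • v) = c * l2norm v := by
  simp [l2norm, norm_smul, abs_of_nonneg hc]

/-- The partial sums of an exponential moving average started at zero are bounded by the
partial sums of the averaged sequence. -/
theorem sum_range_le_of_le_exponential_average {β : ℝ} (hβ : 0 ≤ β) (hβ' : β < 1) {a b : ℕ → ℝ}
    (ha : ∀ n, 0 ≤ a n) (ha0 : a 0 = 0) (hab : ∀ n, a (n + 1) ≤ β * a n + (1 - β) * b n) (n : ℕ) :
    ∑ k ∈ Finset.range n, a (k + 1) ≤ ∑ k ∈ Finset.range n, b k := by
  have key : (1 - β) * ∑ k ∈ Finset.range n, a (k + 1) + β * a n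
      ≤ (1 - β) * ∑ k ∈ Finset.range n, b k := by
    induction n with
    | zero => simp [ha0]
    | succ n ih =>
      rw [Finset.sum_range_succ, Finset.sum_range_succ]
      linarith [hab n]
  have hpos := mul_nonneg hβ (ha n)
  exact le_of_mul_le_mul_left (by linarith) (sub_pos.2 hβ')

/-- intermediate series bound in (19) of the paper: if
`∑_{k=1}^∞ ‖g(k)‖₂` converges with sum at most `C`, `s₁(0) = 0` and
`s₁(k) = β₁ s₁(k−1) + (1−β₁) g(k)`, then `∑_{k=1}^∞ ‖s₁(k)/(1−β₁ᵏ)‖₂` converges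
with sum at most `C/(1−β₁)`. -/
theorem stmt_10 {d : ℕ} (β₁ : ℝ) (hβ₁ : 0 ≤ β₁) (hβ₁' : β₁ < 1) (C : ℝ)
    (g : ℕ → Fin d → ℝ)
    (hg : Summable fun k : ℕ => l2norm (g (k + 1)))
    (hgC : ∑' k : ℕ, l2norm (g (k + 1)) ≤ C)
    (s₁ : ℕ → Fin d → ℝ) (hs0 : s₁ 0 = 0)
    (hs : ∀ k : ℕ, s₁ (k + 1) = β₁ • s₁ k + (1 - β₁) • g (k + 1)) :
    (Summable fun k : ℕ => l2norm ((1 - β₁ ^ (k + 1))⁻¹ • s₁ (k + 1)))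
      ∧ ∑' k : ℕ, l2norm ((1 - β₁ ^ (k + 1))⁻¹ • s₁ (k + 1)) ≤ C / (1 - β₁) := by
  have h1 : 0 < 1 - β₁ := sub_pos.2 hβ₁'
  have hrec : ∀ n, l2norm (s₁ (n + 1)) ≤ β₁ * l2norm (s₁ n) + (1 - β₁) * l2norm (g (n + 1)) := by
    intro n
    rw [hs, ← l2norm_smul_of_nonneg hβ₁, ← l2norm_smul_of_nonneg h1.le]
    exact l2norm_add_le _ _
  have hterm : ∀ k, l2norm ((1 - β₁ ^ (k + 1))⁻¹ • s₁ (k + 1))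
      ≤ (1 - β₁)⁻¹ * l2norm (s₁ (k + 1)) := by
    intro k
    have hpow : 1 - β₁ ≤ 1 - β₁ ^ (k + 1) :=
      sub_le_sub_left (pow_le_of_le_one hβ₁ hβ₁'.le k.succ_ne_zero) 1
    rw [l2norm_smul_of_nonneg (inv_nonneg.2 (h1.le.trans hpow))]
    exact mul_le_mul_of_nonneg_right (inv_anti₀ h1 hpow) (l2norm_nonneg _)
  have hsum : ∀ n, ∑ k ∈ Finset.range n, l2norm ((1 - β₁ ^ (k + 1))⁻¹ • s₁ (k + 1))
      ≤ C / (1 - β₁) := by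
    intro n
    calc ∑ k ∈ Finset.range n, l2norm ((1 - β₁ ^ (k + 1))⁻¹ • s₁ (k + 1))
        ≤ ∑ k ∈ Finset.range n, (1 - β₁)⁻¹ * l2norm (s₁ (k + 1)) :=
          Finset.sum_le_sum fun k _ => hterm k
      _ = (1 - β₁)⁻¹ * ∑ k ∈ Finset.range n, l2norm (s₁ (k + 1)) := (Finset.mul_sum ..).symm
      _ ≤ (1 - β₁)⁻¹ * C := by
          refine mul_le_mul_of_nonneg_left ?_ (inv_nonneg.2 h1.le)
          refine (sum_range_le_of_le_exponential_average (a := fun n => l2norm (s₁ n)) hβ₁ hβ₁'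
            (fun _ => l2norm_nonneg _) (by simp [hs0, l2norm_zero]) hrec n).trans ?_
          exact (hg.sum_le_tsum _ fun _ _ => l2norm_nonneg _).trans hgC
      _ = C / (1 - β₁) := by rw [div_eq_inv_mul]
  exact ⟨summable_of_sum_range_le (fun _ => l2norm_nonneg _) hsum,
    Real.tsum_le_of_sum_range_le (fun _ => l2norm_nonneg _) hsum⟩
end

section
/- Let d be a natural number, β₁ ∈ [0,1), ε > 0, and let g : ℕ → ℝ^d be such that the series ∑_{k=1}^∞ ‖g(k)‖₂ converges with sum at most C. Define s₁ : ℕ → ℝ^d by s₁(0) = 0 and s₁(k) = β₁·s₁(k−1) + (1−β₁)·g(k) for k ≥ 1, set ŝ₁(k) = s₁(k)/(1−β₁ᵏ), and let ŝ₂ : ℕ → ℝ^d be any sequence with all entries nonnegative. Then the series ∑_{k=1}^∞ ‖ŝ₁(k) ./ (√(ŝ₂(k)) + ε)‖₂ converges and its sum is at most C/(ε·(1−β₁)). -/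
theorem l2norm_smul {ι : Type*} [Fintype ι] (c : ℝ) (v : ι → ℝ) :
    l2norm (c • v) = |c| * l2norm v := by
  simpa [l2norm] using norm_smul c (WithLp.toLp 2 v)

theorem l2norm_mono {ι : Type*} [Fintype ι] {v w : ι → ℝ} (h : ∀ i, |v i| ≤ |w i|) :
    l2norm v ≤ l2norm w := by
  simp only [l2norm, EuclideanSpace.norm_eq]
  refine Real.sqrt_le_sqrt (Finset.sum_le_sum fun i _ => ?_)
  exact pow_le_pow_left₀ (norm_nonneg _) (h i) 2

/-- Dividing componentwise by entries that are at least `ε > 0` shrinks the norm by `ε`. -/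
theorem l2norm_div_le {ι : Type*} [Fintype ι] {ε : ℝ} (hε : 0 < ε) (v w : ι → ℝ)
    (hw : ∀ i, ε ≤ w i) : l2norm (fun i => v i / w i) ≤ l2norm v / ε := by
  have h : l2norm (fun i => v i / w i) ≤ l2norm (ε⁻¹ • v) := by
    refine l2norm_mono fun i => ?_
    rw [Pi.smul_apply, smul_eq_mul, abs_mul, abs_div, abs_of_pos (hε.trans_le (hw i)),
      abs_of_pos (inv_pos.2 hε), mul_comm, ← div_eq_mul_inv]
    exact div_le_div_of_nonneg_left (abs_nonneg _) hε (hw i)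
  rwa [l2norm_smul, abs_of_pos (inv_pos.2 hε), mul_comm, ← div_eq_mul_inv] at h

/-- Partial sums of an exponential moving average are bounded by those of its input. -/
theorem sum_moving_average_le {β : ℝ} (hβ : 0 ≤ β) (hβ' : β < 1) {a γ : ℕ → ℝ}
    (ha : ∀ k, 0 ≤ a k) (ha0 : a 0 = 0)
    (h : ∀ k, a (k + 1) ≤ β * a k + (1 - β) * γ k) (n : ℕ) :
    ∑ k ∈ Finset.range n, a (k + 1) ≤ ∑ k ∈ Finset.range n, γ k := by
  have key : (1 - β) * ∑ k ∈ Finset.range n, a (k + 1) + β * a n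
      ≤ (1 - β) * ∑ k ∈ Finset.range n, γ k := by
    induction n with
    | zero => simp [ha0]
    | succ n ih =>
      rw [Finset.sum_range_succ, Finset.sum_range_succ]
      linarith [h n]
  exact le_of_mul_le_mul_left (by linarith [mul_nonneg hβ (ha n)]) (sub_pos.2 hβ')

/-- summability bound (20) in the proof of Theorem 1 of the paper: if
`∑_{k=1}^∞ ‖g(k)‖₂` converges with sum at most `C`, `s₁(0) = 0`,
`s₁(k) = β₁ s₁(k−1) + (1−β₁) g(k)`, `shat₁(k) = s₁(k)/(1−β₁ᵏ)`, and `shat₂` has nonnegative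
entries, then `∑_{k=1}^∞ ‖shat₁(k) ./ (√(shat₂(k)) + ε)‖₂` converges with sum at most
`C/(ε(1−β₁))`. -/
theorem stmt_11 {d : ℕ} (β₁ ε : ℝ) (hβ₁ : 0 ≤ β₁) (hβ₁' : β₁ < 1) (hε : 0 < ε) (C : ℝ)
    (g : ℕ → Fin d → ℝ)
    (hg : Summable fun k : ℕ => l2norm (g (k + 1)))
    (hgC : ∑' k : ℕ, l2norm (g (k + 1)) ≤ C)
    (s₁ : ℕ → Fin d → ℝ) (hs0 : s₁ 0 = 0)
    (hs : ∀ k : ℕ, s₁ (k + 1) = β₁ • s₁ k + (1 - β₁) • g (k + 1))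
    (shat₁ : ℕ → Fin d → ℝ)
    (hshat₁ : ∀ k : ℕ, shat₁ (k + 1) = (1 - β₁ ^ (k + 1))⁻¹ • s₁ (k + 1))
    (shat₂ : ℕ → Fin d → ℝ) (hshat₂ : ∀ (k : ℕ) (i : Fin d), 0 ≤ shat₂ k i) :
    (Summable fun k : ℕ =>
        l2norm (fun i => shat₁ (k + 1) i / (Real.sqrt (shat₂ (k + 1) i) + ε)))
      ∧ ∑' k : ℕ, l2norm (fun i => shat₁ (k + 1) i / (Real.sqrt (shat₂ (k + 1) i) + ε))
          ≤ C / (ε * (1 - β₁)) := by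
  have hpos : 0 < 1 - β₁ := sub_pos.2 hβ₁'
  have hterm : ∀ k : ℕ,
      l2norm (fun i => shat₁ (k + 1) i / (Real.sqrt (shat₂ (k + 1) i) + ε))
        ≤ l2norm (s₁ (k + 1)) / (ε * (1 - β₁)) := by
    intro k
    refine (l2norm_div_le hε _ _ fun i => le_add_of_nonneg_left (Real.sqrt_nonneg _)).trans ?_
    have hpow : 1 - β₁ ≤ 1 - β₁ ^ (k + 1) :=
      sub_le_sub_left (pow_le_of_le_one hβ₁ hβ₁'.le k.succ_ne_zero) 1
    rw [hshat₁, l2norm_smul, abs_of_pos (inv_pos.2 (hpos.trans_le hpow)), mul_comm,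
      ← div_eq_mul_inv, div_div, mul_comm ε]
    exact div_le_div_of_nonneg_left (l2norm_nonneg _) (mul_pos hpos hε)
      (mul_le_mul_of_nonneg_right hpow hε.le)
  have hrec : ∀ k : ℕ,
      l2norm (s₁ (k + 1)) ≤ β₁ * l2norm (s₁ k) + (1 - β₁) * l2norm (g (k + 1)) := by
    intro k
    rw [hs]
    refine (l2norm_add_le _ _).trans_eq ?_
    rw [l2norm_smul, l2norm_smul, abs_of_nonneg hβ₁, abs_of_pos hpos]
  have hpartial : ∀ n : ℕ, ∑ k ∈ Finset.range n,
      l2norm (fun i => shat₁ (k + 1) i / (Real.sqrt (shat₂ (k + 1) i) + ε))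
        ≤ C / (ε * (1 - β₁)) := by
    intro n
    refine (Finset.sum_le_sum fun k _ => hterm k).trans ?_
    rw [← Finset.sum_div]
    refine div_le_div_of_nonneg_right ?_ (mul_pos hε hpos).le
    calc ∑ k ∈ Finset.range n, l2norm (s₁ (k + 1))
        ≤ ∑ k ∈ Finset.range n, l2norm (g (k + 1)) :=
          sum_moving_average_le hβ₁ hβ₁' (a := fun k => l2norm (s₁ k))
            (fun k => l2norm_nonneg _) (by simp only [hs0, l2norm_zero]) hrec n
      _ ≤ ∑' k : ℕ, l2norm (g (k + 1)) := hg.sum_le_tsum _ fun k _ => l2norm_nonneg _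
      _ ≤ C := hgC
  exact ⟨summable_of_sum_range_le (fun k => l2norm_nonneg _) hpartial,
    Real.tsum_le_of_sum_range_le (fun k => l2norm_nonneg _) hpartial⟩
end

section
/- Under the setup of the previous statement (β₁ ∈ [0,1), ε > 0, ∑_{k≥1} ‖g(k)‖₂ ≤ C, s₁(0) = 0, s₁(k) = β₁·s₁(k−1) + (1−β₁)·g(k), ŝ₁(k) = s₁(k)/(1−β₁ᵏ), ŝ₂(k) componentwise nonnegative), let α > 0 and define x : ℕ → ℝ^d by an arbitrary x(0) and x(k) = x(k−1) − α·(ŝ₁(k) ./ (√(ŝ₂(k)) + ε)) for k ≥ 1. Then for all natural numbers k₁, k₂, ‖x(k₁) − x(k₂)‖₂ ≤ α·C/(ε·(1−β₁)). -/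
theorem l2norm_eq_norm_toLp {ι : Type*} [Fintype ι] (v : ι → ℝ) :
    l2norm v = ‖WithLp.toLp 2 v‖ := rfl

/-- The partial sums of norms of an exponential moving average started at zero are bounded by
those of the averaged sequence. -/
theorem sum_norm_movingAverage_le {E : Type*} [SeminormedAddCommGroup E] [NormedSpace ℝ E]
    {β : ℝ} (hβ : 0 ≤ β) (hβ' : β < 1) (g s : ℕ → E) (hs0 : s 0 = 0)
    (hs : ∀ k, s (k + 1) = β • s k + (1 - β) • g (k + 1)) (n : ℕ) :
    ∑ k ∈ Finset.range n, ‖s (k + 1)‖ ≤ ∑ k ∈ Finset.range n, ‖g (k + 1)‖ := by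
  have hβ₁ : 0 < 1 - β := sub_pos.mpr hβ'
  have key : (1 - β) * ∑ k ∈ Finset.range n, ‖s (k + 1)‖ + β * ‖s n‖ ≤
      (1 - β) * ∑ k ∈ Finset.range n, ‖g (k + 1)‖ := by
    induction n with
    | zero => simp [hs0]
    | succ n ih =>
      have h : ‖s (n + 1)‖ ≤ β * ‖s n‖ + (1 - β) * ‖g (n + 1)‖ := by
        rw [hs]
        refine (norm_add_le _ _).trans_eq ?_
        rw [norm_smul, norm_smul, Real.norm_of_nonneg hβ, Real.norm_of_nonneg hβ₁.le]
      rw [Finset.sum_range_succ, Finset.sum_range_succ]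
      linarith
  refine le_of_mul_le_mul_left ?_ hβ₁
  linarith [mul_nonneg hβ (norm_nonneg (s n))]

/-- A sequence whose path length is bounded by `B` has diameter at most `B`. -/
theorem dist_le_of_sum_range_dist_le {E : Type*} [PseudoMetricSpace E] (x : ℕ → E) (B : ℝ)
    (h : ∀ n, ∑ k ∈ Finset.range n, dist (x k) (x (k + 1)) ≤ B) (m n : ℕ) :
    dist (x m) (x n) ≤ B := by
  wlog hmn : m ≤ n generalizing m n
  · rw [dist_comm]
    exact this n m (le_of_not_ge hmn)
  refine (dist_le_Ico_sum_dist x hmn).trans (le_trans ?_ (h n))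
  refine Finset.sum_le_sum_of_subset_of_nonneg (fun k hk => ?_) fun _ _ _ => dist_nonneg
  exact Finset.mem_range.mpr (Finset.mem_Ico.mp hk).2

/-- uniform boundedness of the x-iterates, inequality (21) of the paper:
under the Adam setup (`∑_{k≥1} ‖g(k)‖₂ ≤ C`, `s₁(0)=0`, `s₁(k)=β₁s₁(k−1)+(1−β₁)g(k)`,
`ŝ₁(k)=s₁(k)/(1−β₁ᵏ)`, `ŝ₂` componentwise nonnegative), the iterates
`x(k) = x(k−1) − α (ŝ₁(k) ./ (√(ŝ₂(k)) + ε))` satisfy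
`‖x(k₁) − x(k₂)‖₂ ≤ α C/(ε(1−β₁))` for all `k₁, k₂`. -/
theorem stmt_12 {d : ℕ} (β₁ ε α : ℝ) (hβ₁ : 0 ≤ β₁) (hβ₁' : β₁ < 1) (hε : 0 < ε)
    (hα : 0 < α) (C : ℝ)
    (g : ℕ → Fin d → ℝ)
    (hg : Summable fun k : ℕ => l2norm (g (k + 1)))
    (hgC : ∑' k : ℕ, l2norm (g (k + 1)) ≤ C)
    (s₁ : ℕ → Fin d → ℝ) (hs0 : s₁ 0 = 0)
    (hs : ∀ k : ℕ, s₁ (k + 1) = β₁ • s₁ k + (1 - β₁) • g (k + 1))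
    (shat₁ : ℕ → Fin d → ℝ)
    (hshat₁ : ∀ k : ℕ, shat₁ (k + 1) = (1 - β₁ ^ (k + 1))⁻¹ • s₁ (k + 1))
    (shat₂ : ℕ → Fin d → ℝ) (hshat₂ : ∀ (k : ℕ) (i : Fin d), 0 ≤ shat₂ k i)
    (x : ℕ → Fin d → ℝ)
    (hx : ∀ k : ℕ, x (k + 1) = x k
        - α • (fun i => shat₁ (k + 1) i / (Real.sqrt (shat₂ (k + 1) i) + ε))) :
    ∀ k₁ k₂ : ℕ, l2norm (x k₁ - x k₂) ≤ α * C / (ε * (1 - β₁)) := by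
  have hβ : 0 < 1 - β₁ := sub_pos.mpr hβ₁'
  have hstep : ∀ k, dist (WithLp.toLp 2 (x k)) (WithLp.toLp 2 (x (k + 1))) ≤
      α / (ε * (1 - β₁)) * l2norm (s₁ (k + 1)) := fun k => by
    have hpow : 1 - β₁ ≤ 1 - β₁ ^ (k + 1) :=
      sub_le_sub_left (pow_le_of_le_one hβ₁ hβ₁'.le k.succ_ne_zero) 1
    have hshat : l2norm (shat₁ (k + 1)) ≤ (1 - β₁)⁻¹ * l2norm (s₁ (k + 1)) := by
      rw [hshat₁, l2norm_eq_norm_toLp, l2norm_eq_norm_toLp, WithLp.toLp_smul, norm_smul,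
        Real.norm_of_nonneg (inv_nonneg.mpr (hβ.le.trans hpow))]
      gcongr
    have hdiv := l2norm_div_le hε (shat₁ (k + 1)) (fun i => √(shat₂ (k + 1) i) + ε)
      fun i => le_add_of_nonneg_left (Real.sqrt_nonneg _)
    rw [dist_eq_norm, ← WithLp.toLp_sub, hx, sub_sub_cancel, WithLp.toLp_smul, norm_smul,
      Real.norm_of_nonneg hα.le, ← l2norm_eq_norm_toLp]
    calc _ ≤ α * ((1 - β₁)⁻¹ * l2norm (s₁ (k + 1)) / ε) := by
          gcongr
          exact hdiv.trans (by gcongr)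
      _ = _ := by field_simp
  have hsum : ∀ n, ∑ k ∈ Finset.range n, l2norm (s₁ (k + 1)) ≤ C := fun n =>
    (sum_norm_movingAverage_le hβ₁ hβ₁' (fun k => WithLp.toLp 2 (g k))
      (fun k => WithLp.toLp 2 (s₁ k)) (by simp [hs0]) (fun k => by simp [hs]) n).trans
      ((hg.sum_le_tsum _ fun _ _ => norm_nonneg _).trans hgC)
  intro k₁ k₂
  rw [l2norm_eq_norm_toLp, WithLp.toLp_sub, ← dist_eq_norm]
  refine dist_le_of_sum_range_dist_le (fun k => WithLp.toLp 2 (x k)) _ (fun n => ?_) k₁ k₂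
  calc _ ≤ ∑ k ∈ Finset.range n, α / (ε * (1 - β₁)) * l2norm (s₁ (k + 1)) :=
        Finset.sum_le_sum fun k _ => hstep k
    _ = α / (ε * (1 - β₁)) * ∑ k ∈ Finset.range n, l2norm (s₁ (k + 1)) :=
        (Finset.mul_sum _ _ _).symm
    _ ≤ α / (ε * (1 - β₁)) * C := by
        gcongr
        exact hsum n
    _ = α * C / (ε * (1 - β₁)) := div_mul_eq_mul_div _ _ _
end

section
/- Let d be a natural number, β₁ ∈ [0,1), ε > 0, α > 0, and let g : ℕ → ℝ^d be such that the series ∑_{k=1}^∞ ‖g(k)‖₂ converges. Define s₁ : ℕ → ℝ^d by s₁(0) = 0 and s₁(k) = β₁·s₁(k−1) + (1−β₁)·g(k), set ŝ₁(k) = s₁(k)/(1−β₁ᵏ), let ŝ₂ : ℕ → ℝ^d have all entries nonnegative, and define x : ℕ → ℝ^d by an arbitrary x(0) and x(k) = x(k−1) − α·(ŝ₁(k) ./ (√(ŝ₂(k)) + ε)) for k ≥ 1. Then the sequence x(k) converges as k → ∞. -/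
theorem abs_apply_le_l2norm {ι : Type*} [Fintype ι] (v : ι → ℝ) (i : ι) : |v i| ≤ l2norm v :=
  PiLp.norm_apply_le ((WithLp.equiv 2 (ι → ℝ)).symm v) i

/-- An exponential moving average, started at zero, of an absolutely summable sequence is
absolutely summable. -/
theorem summable_abs_of_exponential_average {β : ℝ} (hβ : 0 ≤ β) (hβ' : β < 1) {a s : ℕ → ℝ}
    (ha : Summable fun k => |a k|) (hs0 : s 0 = 0)
    (hs : ∀ k, s (k + 1) = β * s k + (1 - β) * a k) : Summable fun k => |s k| := by
  refine summable_of_sum_range_le (c := ∑' k, |a k|) (fun _ => abs_nonneg _) fun n => ?_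
  induction n with
  | zero => simpa using tsum_nonneg fun k => abs_nonneg (a k)
  | succ n ih =>
    have hstep : ∀ k, |s (k + 1)| ≤ β * |s k| + (1 - β) * |a k| := fun k => by
      rw [hs]
      refine (abs_add_le _ _).trans_eq ?_
      rw [abs_mul, abs_mul, abs_of_nonneg hβ, abs_of_nonneg (sub_nonneg.2 hβ'.le)]
    have ha_le : ∑ k ∈ Finset.range n, |a k| ≤ ∑' k, |a k| :=
      ha.sum_le_tsum _ fun _ _ => abs_nonneg _
    calc ∑ k ∈ Finset.range (n + 1), |s k|
        = ∑ k ∈ Finset.range n, |s (k + 1)| := by simp [Finset.sum_range_succ', hs0]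
      _ ≤ ∑ k ∈ Finset.range n, (β * |s k| + (1 - β) * |a k|) :=
          Finset.sum_le_sum fun k _ => hstep k
      _ = β * ∑ k ∈ Finset.range n, |s k| + (1 - β) * ∑ k ∈ Finset.range n, |a k| := by
          rw [Finset.sum_add_distrib, Finset.mul_sum, Finset.mul_sum]
      _ ≤ β * ∑' k, |a k| + (1 - β) * ∑' k, |a k| :=
          add_le_add (mul_le_mul_of_nonneg_left ih hβ)
            (mul_le_mul_of_nonneg_left ha_le (sub_nonneg.2 hβ'.le))
      _ = ∑' k, |a k| := by ring

/-- The bias correction by `1 - β ^ (k + 1)` and the division by `√t + ε` enlarge a number by at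
most the factor `((1 - β) * ε)⁻¹`. -/
theorem abs_bias_corrected_div_le {β ε : ℝ} (hβ : 0 ≤ β) (hβ' : β < 1) (hε : 0 < ε)
    (k : ℕ) (u t : ℝ) :
    |(1 - β ^ (k + 1))⁻¹ * u / (√t + ε)| ≤ ((1 - β) * ε)⁻¹ * |u| := by
  have hpow : 1 - β ≤ 1 - β ^ (k + 1) :=
    sub_le_sub_left (pow_le_of_le_one hβ hβ'.le k.succ_ne_zero) 1
  have hβ_pos : 0 < 1 - β := sub_pos.2 hβ'
  have hden : ε ≤ √t + ε := le_add_of_nonneg_left (Real.sqrt_nonneg t)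
  rw [mul_div_right_comm, abs_mul, div_eq_mul_inv, ← mul_inv, abs_inv,
    abs_of_pos (mul_pos (hβ_pos.trans_le hpow) (hε.trans_le hden))]
  have hcorr_nonneg := hβ_pos.le.trans hpow
  gcongr

/-- convergence of the x-iterates of the Adam-type update of Algorithm 1
of the paper: if `∑_{k=1}^∞ ‖g(k)‖₂` converges, `s₁(0) = 0`,
`s₁(k) = β₁ s₁(k−1) + (1−β₁) g(k)`, `ŝ₁(k) = s₁(k)/(1−β₁ᵏ)`, `ŝ₂` has nonnegative
entries, and `x(k) = x(k−1) − α (ŝ₁(k) ./ (√(ŝ₂(k)) + ε))`, then `x(k)` converges. -/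
theorem stmt_13 {d : ℕ} (β₁ ε α : ℝ) (hβ₁ : 0 ≤ β₁) (hβ₁' : β₁ < 1) (hε : 0 < ε)
    (hα : 0 < α)
    (g : ℕ → Fin d → ℝ)
    (hg : Summable fun k : ℕ => l2norm (g (k + 1)))
    (s₁ : ℕ → Fin d → ℝ) (hs0 : s₁ 0 = 0)
    (hs : ∀ k : ℕ, s₁ (k + 1) = β₁ • s₁ k + (1 - β₁) • g (k + 1))
    (shat₁ : ℕ → Fin d → ℝ)
    (hshat₁ : ∀ k : ℕ, shat₁ (k + 1) = (1 - β₁ ^ (k + 1))⁻¹ • s₁ (k + 1))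
    (shat₂ : ℕ → Fin d → ℝ) (hshat₂ : ∀ (k : ℕ) (i : Fin d), 0 ≤ shat₂ k i)
    (x : ℕ → Fin d → ℝ)
    (hx : ∀ k : ℕ, x (k + 1) = x k
        - α • (fun i => shat₁ (k + 1) i / (Real.sqrt (shat₂ (k + 1) i) + ε))) :
    ∃ xlim : Fin d → ℝ, Filter.Tendsto x Filter.atTop (nhds xlim) := by
  have hcoord : ∀ i, ∃ l, Filter.Tendsto (fun k => x k i) Filter.atTop (nhds l) := by
    intro i
    have hs_sum : Summable fun k => |s₁ k i| :=
      summable_abs_of_exponential_average hβ₁ hβ₁'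
        (hg.of_nonneg_of_le (fun _ => abs_nonneg _) fun k => abs_apply_le_l2norm (g (k + 1)) i)
        (by simp [hs0]) fun k => by simp [hs]
    have hbound : ∀ k, dist (x k i) (x (k + 1) i) ≤
        α * (((1 - β₁) * ε)⁻¹ * |s₁ (k + 1) i|) := fun k => by
      rw [Real.dist_eq, hx, hshat₁]
      simp only [Pi.sub_apply, Pi.smul_apply, smul_eq_mul, sub_sub_cancel]
      rw [abs_mul, abs_of_pos hα]
      exact mul_le_mul_of_nonneg_left (abs_bias_corrected_div_le hβ₁ hβ₁' hε k _ _) hα.le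
    exact cauchySeq_tendsto_of_complete <| cauchySeq_of_summable_dist <|
      ((((summable_nat_add_iff 1).2 hs_sum).mul_left _).mul_left _).of_nonneg_of_le
        (fun _ => dist_nonneg) hbound
  choose l hl using hcoord
  exact ⟨l, tendsto_pi_nhds.2 hl⟩
end
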